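/- Let V ⊆ ℂ be an open set and let G, h be holomorphic functions on V with G, G' and h nowhere vanishing on V. Set u = log(1 + |G|²) − (1/2) log|G G' / h| − log 2 (so that u = −(1/4) log|K_g| for the Gauss curvature K_g = −16|G G'|²/(|h|²(1 + |G|²)⁴) of the minimal-surface metric induced by the Weierstrass data (G, h dz)). Then on V: ∂²_zz u + (1/2)(G'/G − G''/G' − h'/h) ∂_z u + (∂_z u)² = −ρ[G,h]/4, where ρ[G,h] = G'''/G' + G''/(2G) − 3(G')²/(4G²) − 7(G'')²/(4(G')²) + G'' h'/(2 G' h) − G' h'/(2 G h) − h''/h + 5(h')²/(4h²). (This is the coordinate expression of the entropy differential P = (ρ[G,h]/2) dz² in terms of Weierstrass data.) -/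

import Mathlib

/-- The Wirtinger derivative `∂_z f = (1/2)(∂_x f - i ∂_y f)`. -/
noncomputable def wirtingerZ (f : ℂ → ℂ) (z : ℂ) : ℂ :=
  (1 / 2) * (fderiv ℝ f z 1 - Complex.I * fderiv ℝ f z Complex.I)

/-- The coefficient `ρ[G,h]` of the entropy differential `P = (ρ/2) dz²` of the
minimal surface with Weierstrass data `(G, h dz)`. -/
noncomputable def rhoWeierstrass (G h : ℂ → ℂ) (z : ℂ) : ℂ :=
  deriv (deriv (deriv G)) z / deriv G z
    + deriv (deriv G) z / (2 * G z)
    - 3 * (deriv G z) ^ 2 / (4 * (G z) ^ 2)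
    - 7 * (deriv (deriv G) z) ^ 2 / (4 * (deriv G z) ^ 2)
    + deriv (deriv G) z * deriv h z / (2 * deriv G z * h z)
    - deriv G z * deriv h z / (2 * G z * h z)
    - deriv (deriv h) z / h z
    + 5 * (deriv h z) ^ 2 / (4 * (h z) ^ 2)

/-- `f` is real differentiable at `z` and its Wirtinger derivative `∂_z f` there equals `a`. -/
def HasWirtingerZAt (f : ℂ → ℂ) (a z : ℂ) : Prop :=
  ∃ L : ℂ →L[ℝ] ℂ, HasFDerivAt f L z ∧ (1 / 2) * (L 1 - Complex.I * L Complex.I) = a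

namespace HasWirtingerZAt

variable {f g : ℂ → ℂ} {a b z : ℂ}

theorem wirtingerZ_eq (hf : HasWirtingerZAt f a z) : wirtingerZ f z = a := by
  obtain ⟨L, hL, rfl⟩ := hf
  rw [wirtingerZ, hL.fderiv]

theorem congr_of_eventuallyEq (hf : HasWirtingerZAt f a z) (hfg : g =ᶠ[nhds z] f) :
    HasWirtingerZAt g a z := by
  obtain ⟨L, hL, ha⟩ := hf
  exact ⟨L, hL.congr_of_eventuallyEq hfg, ha⟩

theorem const (c : ℂ) : HasWirtingerZAt (fun _ => c) 0 z :=
  ⟨0, hasFDerivAt_const c z, by simp⟩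

theorem of_hasDerivAt (hf : HasDerivAt f a z) : HasWirtingerZAt f a z := by
  refine ⟨_, hf.hasFDerivAt.restrictScalars ℝ, ?_⟩
  simp only [ContinuousLinearMap.coe_restrictScalars', ContinuousLinearMap.toSpanSingleton_apply,
    smul_eq_mul]
  linear_combination (-a / 2) * Complex.I_sq

theorem conj_of_hasDerivAt (hf : HasDerivAt f a z) :
    HasWirtingerZAt (fun w => (starRingEnd ℂ) (f w)) 0 z := by
  refine ⟨_, Complex.conjCLE.toContinuousLinearMap.hasFDerivAt.comp z
    (hf.hasFDerivAt.restrictScalars ℝ), ?_⟩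
  simp only [ContinuousLinearMap.comp_apply, ContinuousLinearMap.coe_restrictScalars',
    ContinuousLinearMap.toSpanSingleton_apply, smul_eq_mul, ContinuousLinearEquiv.coe_coe,
    Complex.conjCLE_apply, map_mul, map_one, Complex.conj_I]
  linear_combination ((starRingEnd ℂ) a / 2) * Complex.I_sq

theorem add (hf : HasWirtingerZAt f a z) (hg : HasWirtingerZAt g b z) :
    HasWirtingerZAt (fun w => f w + g w) (a + b) z := by
  obtain ⟨L, hL, rfl⟩ := hf
  obtain ⟨M, hM, rfl⟩ := hg
  refine ⟨_, hL.add hM, ?_⟩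
  simp only [add_apply]
  ring

theorem mul (hf : HasWirtingerZAt f a z) (hg : HasWirtingerZAt g b z) :
    HasWirtingerZAt (fun w => f w * g w) (a * g z + f z * b) z := by
  obtain ⟨L, hL, rfl⟩ := hf
  obtain ⟨M, hM, rfl⟩ := hg
  refine ⟨_, hL.mul hM, ?_⟩
  simp only [add_apply, smul_apply, smul_eq_mul]
  ring

theorem const_mul (c : ℂ) (hf : HasWirtingerZAt f a z) :
    HasWirtingerZAt (fun w => c * f w) (c * a) z := by
  simpa using (const c).mul hf

theorem sub (hf : HasWirtingerZAt f a z) (hg : HasWirtingerZAt g b z) :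
    HasWirtingerZAt (fun w => f w - g w) (a - b) z := by
  simpa [sub_eq_add_neg] using hf.add (hg.const_mul (-1))

theorem inv (hf : HasWirtingerZAt f a z) (h0 : f z ≠ 0) :
    HasWirtingerZAt (fun w => (f w)⁻¹) (-a / f z ^ 2) z := by
  obtain ⟨L, hL, rfl⟩ := hf
  refine ⟨_, ((hasDerivAt_inv h0).hasFDerivAt.restrictScalars ℝ).comp z hL, ?_⟩
  simp only [ContinuousLinearMap.comp_apply, ContinuousLinearMap.coe_restrictScalars',
    ContinuousLinearMap.toSpanSingleton_apply, smul_eq_mul]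
  ring

theorem div (hf : HasWirtingerZAt f a z) (hg : HasWirtingerZAt g b z) (h0 : g z ≠ 0) :
    HasWirtingerZAt (fun w => f w / g w) ((a * g z - f z * b) / g z ^ 2) z := by
  have key := hf.mul (hg.inv h0)
  have hab : a * (g z)⁻¹ + f z * (-b / g z ^ 2) = (a * g z - f z * b) / g z ^ 2 := by
    field_simp
    ring
  rw [hab] at key
  simpa only [div_eq_mul_inv] using key

theorem ofReal_log {r : ℂ → ℝ} (hr : HasWirtingerZAt (fun w => (r w : ℂ)) a z) (h0 : r z ≠ 0) :
    HasWirtingerZAt (fun w => (Real.log (r w) : ℂ)) (a / r z) z := by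
  obtain ⟨L, hL, rfl⟩ := hr
  have hre : HasFDerivAt r (Complex.reCLM.comp L) z := Complex.reCLM.hasFDerivAt.comp z hL
  have hLre : L = Complex.ofRealCLM.comp (Complex.reCLM.comp L) :=
    hL.unique (Complex.ofRealCLM.hasFDerivAt.comp z hre)
  refine ⟨_, Complex.ofRealCLM.hasFDerivAt.comp z (hre.log h0), ?_⟩
  have hLv : ∀ v, ((L v).re : ℂ) = L v := fun v => (DFunLike.congr_fun hLre v).symm
  simp only [ContinuousLinearMap.comp_apply, smul_apply, smul_eq_mul,
    Complex.ofRealCLM_apply, Complex.reCLM_apply, Complex.ofReal_mul, Complex.ofReal_inv, hLv]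
  ring

theorem normSq_of_hasDerivAt (hf : HasDerivAt f a z) :
    HasWirtingerZAt (fun w => ((‖f w‖ ^ 2 : ℝ) : ℂ)) (a * (starRingEnd ℂ) (f z)) z := by
  have key := (of_hasDerivAt hf).mul (conj_of_hasDerivAt hf)
  simp only [Complex.mul_conj, Complex.normSq_eq_norm_sq, mul_zero, add_zero] at key
  exact key

theorem log_norm_of_hasDerivAt (hf : HasDerivAt f a z) (h0 : f z ≠ 0) :
    HasWirtingerZAt (fun w => (Real.log ‖f w‖ : ℂ)) (a / f z / 2) z := by
  have hn : ‖f z‖ ^ 2 ≠ 0 := pow_ne_zero 2 (norm_ne_zero_iff.mpr h0)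
  have key := ((normSq_of_hasDerivAt hf).ofReal_log hn).const_mul (1 / 2)
  have hc : (starRingEnd ℂ) (f z) ≠ 0 := (map_ne_zero _).mpr h0
  have hval : 1 / 2 * (a * (starRingEnd ℂ) (f z) / ((‖f z‖ ^ 2 : ℝ) : ℂ)) = a / f z / 2 := by
    rw [← Complex.normSq_eq_norm_sq, ← Complex.mul_conj]
    field_simp
  rw [hval] at key
  refine key.congr_of_eventuallyEq (Filter.Eventually.of_forall fun w => ?_)
  simp only [Real.log_pow]
  push_cast
  ring

theorem log_one_add_normSq_of_hasDerivAt (hf : HasDerivAt f a z) :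
    HasWirtingerZAt (fun w => (Real.log (1 + ‖f w‖ ^ 2) : ℂ))
      (a * (starRingEnd ℂ) (f z) / (1 + f z * (starRingEnd ℂ) (f z))) z := by
  have hsum := (const (z := z) 1).add (normSq_of_hasDerivAt hf)
  rw [zero_add] at hsum
  have hr : HasWirtingerZAt (fun w => ((1 + ‖f w‖ ^ 2 : ℝ) : ℂ)) (a * (starRingEnd ℂ) (f z)) z := by
    simpa using hsum
  have key := hr.ofReal_log (by positivity)
  rw [Complex.mul_conj, Complex.normSq_eq_norm_sq]
  simpa using key

end HasWirtingerZAt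

theorem one_add_mul_conj_ne_zero (w : ℂ) : 1 + w * (starRingEnd ℂ) w ≠ 0 := by
  rw [Complex.mul_conj]
  have h : 1 + Complex.normSq w ≠ 0 :=
    (add_pos_of_pos_of_nonneg one_pos (Complex.normSq_nonneg w)).ne'
  exact_mod_cast h

/-- For Weierstrass data `(G, h dz)` on an open set `V` with `G`, `G'`, `h`
nowhere vanishing, the function `u = log(1+|G|²) - (1/2) log|G G'/h| - log 2`
(which is `-(1/4) log|K_g|`) satisfies
`∂²_zz u + (1/2)(G'/G - G''/G' - h'/h) ∂_z u + (∂_z u)² = -ρ[G,h]/4` on `V`. -/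
theorem entropy_differential_weierstrass
    (V : Set ℂ) (hV : IsOpen V) (G h : ℂ → ℂ)
    (hG : DifferentiableOn ℂ G V) (hh : DifferentiableOn ℂ h V)
    (hGne : ∀ z ∈ V, G z ≠ 0) (hG'ne : ∀ z ∈ V, deriv G z ≠ 0)
    (hhne : ∀ z ∈ V, h z ≠ 0)
    (u : ℂ → ℝ)
    (hu : ∀ z, u z = Real.log (1 + ‖G z‖ ^ 2)
      - (1 / 2) * Real.log ‖G z * deriv G z / h z‖ - Real.log 2) :
    ∀ z ∈ V,
      wirtingerZ (wirtingerZ (fun w => (u w : ℂ))) z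
        + (1 / 2) * (deriv G z / G z - deriv (deriv G) z / deriv G z
            - deriv h z / h z) * wirtingerZ (fun w => (u w : ℂ)) z
        + (wirtingerZ (fun w => (u w : ℂ)) z) ^ 2
      = -(rhoWeierstrass G h z) / 4 := by
  have hG1 : DifferentiableOn ℂ (deriv G) V := hG.deriv hV
  have hG2 : DifferentiableOn ℂ (deriv (deriv G)) V := hG1.deriv hV
  have hh1 : DifferentiableOn ℂ (deriv h) V := hh.deriv hV
  have hasDeriv : ∀ {f : ℂ → ℂ}, DifferentiableOn ℂ f V → ∀ z ∈ V, HasDerivAt f (deriv f z) z :=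
    fun hf z hz => (hf.differentiableAt (hV.mem_nhds hz)).hasDerivAt
  have hu1 : ∀ z ∈ V, wirtingerZ (fun w => (u w : ℂ)) z =
      deriv G z * (starRingEnd ℂ) (G z) / (1 + G z * (starRingEnd ℂ) (G z))
        - (1 / 4) * (deriv G z / G z + deriv (deriv G) z / deriv G z - deriv h z / h z) := by
    intro z hz
    have h0 := hGne z hz
    have h1 := hG'ne z hz
    have h2 := hhne z hz
    have hF := ((hasDeriv hG z hz).mul (hasDeriv hG1 z hz)).div (hasDeriv hh z hz) h2
    have key := ((HasWirtingerZAt.log_one_add_normSq_of_hasDerivAt (hasDeriv hG z hz)).sub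
      ((HasWirtingerZAt.log_norm_of_hasDerivAt hF
        (div_ne_zero (mul_ne_zero h0 h1) h2)).const_mul (1 / 2))).sub
      (HasWirtingerZAt.const (Real.log 2 : ℂ))
    have hu' : HasWirtingerZAt (fun w => (u w : ℂ)) _ z :=
      key.congr_of_eventuallyEq (Filter.Eventually.of_forall fun w => by
        simp only [hu]
        push_cast
        rfl)
    rw [hu'.wirtingerZ_eq, sub_zero]
    congr 1
    simp only [Pi.mul_apply, Pi.div_apply]
    field_simp
    ring
  intro z hz
  have h0 := hGne z hz
  have h1 := hG'ne z hz
  have h2 := hhne z hz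
  have hD := one_add_mul_conj_ne_zero (G z)
  have dG := HasWirtingerZAt.of_hasDerivAt (hasDeriv hG z hz)
  have dG1 := HasWirtingerZAt.of_hasDerivAt (hasDeriv hG1 z hz)
  have dG2 := HasWirtingerZAt.of_hasDerivAt (hasDeriv hG2 z hz)
  have dh := HasWirtingerZAt.of_hasDerivAt (hasDeriv hh z hz)
  have dh1 := HasWirtingerZAt.of_hasDerivAt (hasDeriv hh1 z hz)
  have dGc := HasWirtingerZAt.conj_of_hasDerivAt (hasDeriv hG z hz)
  have key := ((dG1.mul dGc).div ((HasWirtingerZAt.const 1).add (dG.mul dGc)) hD).sub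
    ((((dG1.div dG h0).add (dG2.div dG1 h1)).sub (dh1.div dh h2)).const_mul (1 / 4))
  have hu2 := (key.congr_of_eventuallyEq
    (Filter.eventuallyEq_of_mem (hV.mem_nhds hz) hu1)).wirtingerZ_eq
  rw [hu2, hu1 z hz, rhoWeierstrass]
  generalize (starRingEnd ℂ) (G z) = c at hD ⊢
  obtain ⟨D, hDc⟩ : ∃ D, D = 1 + G z * c := ⟨_, rfl⟩
  have hc : c = (D - 1) / G z := by
    rw [hDc]
    field_simp
    ring
  rw [← hDc] at hD ⊢
  rw [hc]
  field_simp
  ring
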